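/- (Cut and paste, periodic case.) Let ℓ ≥ 1 and N > 2ℓ+2, and set Ñ = N − (ℓ+2), so Ñ > ℓ. For every f ≥ ℓ, the cohomology H_Q^f of the unit-coupling supercharge of the M_ℓ model on the closed chain of N sites with periodic boundary conditions is isomorphic to the cohomology H_Q^{f−ℓ} of the M_ℓ model on the closed chain of Ñ sites with periodic boundary conditions; in particular their dimensions are equal. -/

import Mathlib

attribute [local instance 10] Classical.propDecidable

noncomputable section

/-- A configuration of `N` sites: `true` = occupied, `false` = empty. -/
abbrev Config (N : ℕ) := Fin N → Bool

/-- Extension of a configuration to all of `ℕ`, by empty sites outside the chain. -/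
def extc {N : ℕ} (σ : Config N) (t : ℕ) : Bool :=
  if h : t < N then σ ⟨t, h⟩ else false

/-- The fermion number: the number of occupied sites. -/
def fermions {N : ℕ} (σ : Config N) : ℕ :=
  (Finset.univ.filter fun i => σ i = true).card

/-- Allowed configurations of the open chain of `N` sites with exclusion parameter `ℓ`
and special boundary conditions `(c₁, cN)`: no cluster is longer than `ℓ`, the cluster
containing the first site (if occupied) has length at most `c₁`, and the cluster
containing the last site (if occupied) has length at most `cN`. -/
def OpenOK (N ℓ c₁ cN : ℕ) (σ : Config N) : Prop :=
  (∀ a : ℕ, ¬ ∀ k ≤ ℓ, extc σ (a + k) = true) ∧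
  (¬ (c₁ + 1 ≤ N ∧ ∀ k ≤ c₁, extc σ k = true)) ∧
  (¬ (cN + 1 ≤ N ∧ ∀ k ≤ cN, extc σ (N - 1 - k) = true))

/-- Cyclic shift of a site of the closed chain by `k` steps. -/
def cyc {N : ℕ} (i : Fin N) (k : ℕ) : Fin N :=
  ⟨(i.1 + k) % N, Nat.mod_lt _ i.pos⟩

/-- Allowed configurations of the closed chain of `N` sites with periodic boundary
conditions: the chain is not fully occupied and no maximal cyclic run of occupied
sites is longer than `ℓ`. -/
def PerOK (N ℓ : ℕ) (σ : Config N) : Prop :=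
  ∀ i : Fin N, ∃ k ≤ ℓ, σ (cyc i k) = false

/-- The fermionic sign `(-1)^{#{j < i : σ j = 1}}`. -/
def sgn {N : ℕ} (σ : Config N) (i : Fin N) : ℂ :=
  (-1 : ℂ) ^ ((Finset.univ.filter fun j => j < i ∧ σ j = true).card)

/-- The Hilbert space `V_N`: complex functions on allowed configurations. -/
abbrev AState (N : ℕ) (OK : Config N → Prop) := {σ : Config N // OK σ} → ℂ

/-- Matrix of the supercharge with amplitudes `A`, with particle insertion
restricted to the sublattice `S`: the entry `(τ, σ)` is the amplitude (with fermionic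
sign) for obtaining `τ` from `σ` by occupying an empty site of `S`. -/
def QmatA (N : ℕ) (OK : Config N → Prop) (S : Fin N → Prop)
    (A : Config N → Fin N → ℂ) :
    Matrix {σ : Config N // OK σ} {σ : Config N // OK σ} ℂ := fun τ σ =>
  ∑ i : Fin N,
    if S i ∧ σ.1 i = false ∧ τ.1 = Function.update σ.1 i true
    then A σ.1 i * sgn σ.1 i else 0

/-- The supercharge with amplitudes `A` restricted to the sublattice `S`, as a linear map. -/
def QopA (N : ℕ) (OK : Config N → Prop) (S : Fin N → Prop)
    (A : Config N → Fin N → ℂ) : AState N OK →ₗ[ℂ] AState N OK :=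
  (QmatA N OK S A).mulVecLin

/-- The unit-coupling supercharge restricted to the sublattice `S`. -/
def Qop (N : ℕ) (OK : Config N → Prop) (S : Fin N → Prop) :
    AState N OK →ₗ[ℂ] AState N OK :=
  QopA N OK S fun _ _ => 1

/-- The subspace `V_{N,f}` of states supported on configurations with fermion number `f`. -/
def gradeV (N : ℕ) (OK : Config N → Prop) (f : ℕ) :
    Submodule ℂ (AState N OK) where
  carrier := {ψ | ∀ σ, fermions σ.1 ≠ f → ψ σ = 0}
  add_mem' := by
    intro a b ha hb σ h
    show a σ + b σ = 0
    rw [ha σ h, hb σ h, add_zero]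
  zero_mem' := by intro σ h; rfl
  smul_mem' := by
    intro c a ha σ h
    show c * a σ = 0
    rw [ha σ h, mul_zero]

/-- The cocycles at gradeV `f`: `ker Q ∩ V_{N,f}` (for the supercharge restricted to `S`). -/
def cocycles (N : ℕ) (OK : Config N → Prop) (S : Fin N → Prop) (f : ℕ) :
    Submodule ℂ (AState N OK) :=
  LinearMap.ker (Qop N OK S) ⊓ gradeV N OK f

/-- The coboundaries at gradeV `f`: `Q (V_{N,f-1})` (for the supercharge restricted to `S`). -/
def cobounds (N : ℕ) (OK : Config N → Prop) (S : Fin N → Prop) (f : ℕ) :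
    Submodule ℂ (AState N OK) :=
  (gradeV N OK (f - 1)).map (Qop N OK S)

/-- The cohomology `H_Q^f = ker (Q : V_{N,f} → V_{N,f+1}) / Q (V_{N,f-1})`. -/
abbrev CohSpace (N : ℕ) (OK : Config N → Prop) (S : Fin N → Prop) (f : ℕ) :=
  cocycles N OK S f ⧸ ((cobounds N OK S f).comap (cocycles N OK S f).subtype)

/-- The dimension of `H_Q^f`. -/
def cohDim (N : ℕ) (OK : Config N → Prop) (S : Fin N → Prop) (f : ℕ) : ℕ :=
  Module.finrank ℂ (CohSpace N OK S f)

/-- The cohomology class represented by a cocycle. -/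
def cohClass (N : ℕ) (OK : Config N → Prop) (S : Fin N → Prop) (f : ℕ)
    (ψ : AState N OK) (h : ψ ∈ cocycles N OK S f) : CohSpace N OK S f :=
  Submodule.Quotient.mk ⟨ψ, h⟩

/-- The supercharge on functions on all configurations, ignoring the exclusion constraint. -/
def diff {N : ℕ} (Ψ : Config N → ℂ) (τ : Config N) : ℂ :=
  ∑ x, if τ x = true then sgn τ x * Ψ (Function.update τ x false) else 0

/-- Extension of a state by zero to all configurations. -/
def ext0 {N : ℕ} {OK : Config N → Prop} (ψ : AState N OK) (σ : Config N) : ℂ :=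
  if h : OK σ then ψ ⟨σ, h⟩ else 0

theorem ext0_val {N : ℕ} {OK : Config N → Prop} (ψ : AState N OK) (σ : {σ // OK σ}) :
    ext0 ψ σ.1 = ψ σ := by
  simp [ext0, σ.2]

theorem sgn_mul_self {N : ℕ} (σ : Config N) (i : Fin N) : sgn σ i * sgn σ i = 1 := by
  unfold sgn
  rw [← mul_pow]
  simp

theorem sgn_update_of_le {N : ℕ} (σ : Config N) {i j : Fin N} (h : i ≤ j) (b : Bool) :
    sgn (Function.update σ j b) i = sgn σ i := by
  unfold sgn
  congr 2
  ext k
  simp only [Finset.mem_filter, Finset.mem_univ, true_and, and_congr_right_iff]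
  intro hk
  rw [Function.update_of_ne (by rintro rfl; exact absurd (lt_of_lt_of_le hk h) (lt_irrefl _))]

theorem sgn_update_true_of_lt {N : ℕ} (σ : Config N) {i j : Fin N} (h : j < i)
    (hj : σ j = false) : sgn (Function.update σ j true) i = -sgn σ i := by
  unfold sgn
  have : (Finset.univ.filter fun k => k < i ∧ Function.update σ j true k = true) =
      insert j (Finset.univ.filter fun k => k < i ∧ σ k = true) := by
    ext k
    by_cases hk : k = j
    · subst hk; simp [h]
    · simp [hk]
  rw [this, Finset.card_insert_of_notMem (by simp [hj]), pow_succ]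
  ring

theorem sgn_update_false_of_lt {N : ℕ} (σ : Config N) {i j : Fin N} (h : j < i)
    (hj : σ j = true) : sgn (Function.update σ j false) i = -sgn σ i := by
  have := sgn_update_true_of_lt (Function.update σ j false) h (by simp)
  rw [Function.update_idem, ← hj, Function.update_eq_self] at this
  rw [this, neg_neg]

theorem diff_diff {N : ℕ} (Ψ : Config N → ℂ) (τ : Config N) : diff (diff Ψ) τ = 0 := by
  let F : Fin N → Fin N → ℂ := fun x y =>
    if τ x = true ∧ τ y = true ∧ x ≠ y then
      sgn τ x * (sgn (Function.update τ x false) y *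
        Ψ (Function.update (Function.update τ x false) y false)) else 0
  have hF : diff (diff Ψ) τ = ∑ x, ∑ y, F x y := by
    unfold diff
    refine Finset.sum_congr rfl fun x _ => ?_
    by_cases hx : τ x = true
    · rw [if_pos hx, Finset.mul_sum]
      refine Finset.sum_congr rfl fun y _ => ?_
      by_cases hxy : x = y
      · subst hxy; simp [F]
      · by_cases hy : τ y = true <;> simp [F, hx, hy, hxy, Function.update_of_ne (Ne.symm hxy)]
    · simp [F, hx]
  have hlt : ∀ x y, x < y → F x y = -F y x := by
    intro x y h
    by_cases hc : τ x = true ∧ τ y = true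
    · have h1 := sgn_update_false_of_lt τ h hc.1
      have h2 := sgn_update_of_le τ h.le false
      simp only [F, hc, h.ne, h.ne', ne_eq, not_false_eq_true, and_self, if_true, h1, h2]
      rw [Function.update_comm h.ne]
      ring
    · have hc' : ¬ (τ y = true ∧ τ x = true) := fun h => hc ⟨h.2, h.1⟩
      simp only [F]
      rw [if_neg (by tauto), if_neg (by tauto), neg_zero]
  have hanti : ∀ x y, F x y = -F y x := by
    intro x y
    rcases lt_trichotomy x y with h | h | h
    · exact hlt x y h
    · subst h; simp [F]
    · rw [hlt y x h, neg_neg]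
  have hneg : ∑ x, ∑ y, F x y = -∑ x, ∑ y, F x y := by
    conv_lhs => rw [Finset.sum_comm]
    rw [← Finset.sum_neg_distrib]
    refine Finset.sum_congr rfl fun x _ => ?_
    rw [← Finset.sum_neg_distrib]
    exact Finset.sum_congr rfl fun y _ => hanti y x
  rw [hF]
  exact self_eq_neg.mp hneg

theorem Qop_apply {N : ℕ} {OK : Config N → Prop}
    (hOK : ∀ τ x, OK τ → OK (Function.update τ x false)) (ψ : AState N OK)
    (Ψ : Config N → ℂ) (hΨ : ∀ σ : {σ // OK σ}, Ψ σ.1 = ψ σ) (τ : {σ // OK σ}) :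
    Qop N OK (fun _ => True) ψ τ = diff Ψ τ.1 := by
  simp only [Qop, QopA, Matrix.mulVecLin_apply, Matrix.mulVec, dotProduct, QmatA,
    Finset.sum_mul, diff]
  rw [Finset.sum_comm]
  refine Finset.sum_congr rfl fun x _ => ?_
  by_cases hx : τ.1 x = true
  · rw [if_pos hx, Finset.sum_eq_single ⟨Function.update τ.1 x false, hOK _ _ τ.2⟩]
    · rw [if_pos ⟨trivial, by simp, by simp [← hx]⟩, ← hΨ, one_mul, sgn_update_of_le _ le_rfl]
    · intro σ _ hσ
      rw [if_neg, zero_mul]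
      rintro ⟨-, h1, h2⟩
      apply hσ
      ext1
      simp only [h2, Function.update_idem, ← h1, Function.update_eq_self]
    · simp
  · rw [if_neg hx]
    refine Finset.sum_eq_zero fun σ _ => ?_
    rw [if_neg, zero_mul]
    rintro ⟨-, -, h2⟩
    simp [h2] at hx

theorem Qop_Qop {N : ℕ} {OK : Config N → Prop}
    (hOK : ∀ τ x, OK τ → OK (Function.update τ x false)) (ψ : AState N OK) :
    Qop N OK (fun _ => True) (Qop N OK (fun _ => True) ψ) = 0 := by
  funext τ
  have hQ := fun σ => (Qop_apply hOK ψ (ext0 ψ) (ext0_val ψ) σ).symm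
  rw [Qop_apply hOK _ _ hQ, diff_diff, Pi.zero_apply]

theorem perOK_update {N ℓ : ℕ} (τ : Config N) (x : Fin N) (h : PerOK N ℓ τ) :
    PerOK N ℓ (Function.update τ x false) := by
  intro i
  obtain ⟨k, hk, hf⟩ := h i
  refine ⟨k, hk, ?_⟩
  by_cases hx : cyc i k = x
  · simp [hx]
  · rw [Function.update_of_ne hx, hf]

theorem perOK_iff {N ℓ : ℕ} (hN : 0 < N) (τ : Config N) :
    PerOK N ℓ τ ↔ ∀ s : ℕ, ∃ k ≤ ℓ, extc τ ((s + k) % N) = false := by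
  constructor
  · intro h s
    obtain ⟨k, hk, hf⟩ := h ⟨s % N, Nat.mod_lt _ hN⟩
    refine ⟨k, hk, ?_⟩
    simpa [extc, Nat.mod_lt _ hN, cyc] using hf
  · intro h i
    obtain ⟨k, hk, hf⟩ := h i
    refine ⟨k, hk, ?_⟩
    simpa [extc, Nat.mod_lt _ hN, cyc] using hf

theorem perOK_iff_exists_hole {N ℓ : ℕ} (hN : ℓ < N) (τ : Config N) :
    PerOK N ℓ τ ↔ ∀ s ≤ N, ∃ t < N, ((s ≤ t ∧ t ≤ s + ℓ) ∨ t + N ≤ s + ℓ) ∧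
      extc τ t = false := by
  rw [perOK_iff (by omega)]
  constructor
  · intro h s hs
    obtain ⟨k, hk, hf⟩ := h s
    refine ⟨(s + k) % N, Nat.mod_lt _ (by omega), ?_, hf⟩
    rcases lt_or_ge (s + k) N with h1 | h1
    · rw [Nat.mod_eq_of_lt h1]; omega
    · rw [Nat.mod_eq_sub_mod h1, Nat.mod_eq_of_lt (by omega)]; omega
  · intro h s
    have hsN : s % N < N := Nat.mod_lt _ (by omega)
    obtain ⟨t, ht, hc, hf⟩ := h (s % N) hsN.le
    rcases hc with hc | hc
    · refine ⟨t - s % N, by omega, ?_⟩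
      rw [← Nat.mod_add_mod, show s % N + (t - s % N) = t by omega, Nat.mod_eq_of_lt ht, hf]
    · refine ⟨t + N - s % N, by omega, ?_⟩
      rw [← Nat.mod_add_mod, show s % N + (t + N - s % N) = t + N by omega, Nat.add_mod_right,
        Nat.mod_eq_of_lt ht, hf]

/-- Restriction of a configuration to the first `n` sites. -/
def trunc {n k : ℕ} (τ : Config (n + k)) : Config n := fun i => τ (Fin.castAdd k i)

/-- The configuration obtained from `σ` by pasting `ℓ + 2` sites of the form `1ⁱ 00 1^(ℓ-i)`
at the end. -/
def paste (ℓ : ℕ) {n : ℕ} (σ : Config n) (i : ℕ) : Config (n + (ℓ + 2)) := fun x =>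
  if h : x.1 < n then σ ⟨x.1, h⟩ else decide (x.1 ≠ n + i ∧ x.1 ≠ n + i + 1)

theorem extc_val {N : ℕ} (σ : Config N) (x : Fin N) : extc σ x.1 = σ x := by
  simp [extc]

theorem extc_update {N : ℕ} (σ : Config N) (x : Fin N) (b : Bool) (t : ℕ) :
    extc (Function.update σ x b) t = if t = x.1 then b else extc σ t := by
  by_cases ht : t = x.1
  · subst ht; simp [extc]
  · by_cases hN : t < N
    · simp [extc, hN, ht, Fin.ext_iff]
    · simp [extc, hN, ht]

theorem config_ext {N : ℕ} {σ τ : Config N} (h : ∀ t < N, extc σ t = extc τ t) : σ = τ := by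
  funext x
  rw [← extc_val σ, ← extc_val τ, h _ x.2]

theorem extc_trunc {n k : ℕ} (τ : Config (n + k)) {t : ℕ} (ht : t < n) :
    extc (trunc τ) t = extc τ t := by
  simp [extc, trunc, ht, Nat.lt_add_right]

theorem extc_paste_left {ℓ n : ℕ} (σ : Config n) (i : ℕ) {t : ℕ} (ht : t < n) :
    extc (paste ℓ σ i) t = extc σ t := by
  simp [extc, paste, ht, Nat.lt_add_right]

theorem extc_paste_eq_false_iff {ℓ n : ℕ} (σ : Config n) (i : ℕ) {t : ℕ} (ht : n ≤ t)
    (ht' : t < n + (ℓ + 2)) : extc (paste ℓ σ i) t = false ↔ t = n + i ∨ t = n + i + 1 := by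
  simp only [extc, paste, ht', dif_pos, not_lt.mpr ht, dif_neg, not_false_eq_true,
    decide_eq_false_iff_not]
  omega

theorem trunc_paste {ℓ n : ℕ} (σ : Config n) (i : ℕ) : trunc (paste ℓ σ i) = σ :=
  config_ext fun t ht => by rw [extc_trunc _ ht, extc_paste_left _ _ ht]

theorem perOK_of_paste {ℓ n i : ℕ} (hn : ℓ < n) (hi : i ≤ ℓ) (σ : Config n)
    (h : PerOK (n + (ℓ + 2)) ℓ (paste ℓ σ i)) : PerOK n ℓ σ := by
  rw [perOK_iff_exists_hole hn]
  rw [perOK_iff_exists_hole (by omega)] at h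
  intro s hs
  obtain ⟨t, ht, hc, hf⟩ := h s (by omega)
  by_cases htn : t < n
  · rw [extc_paste_left _ _ htn] at hf
    exact ⟨t, htn, by omega, hf⟩
  · rw [extc_paste_eq_false_iff _ _ (by omega) ht] at hf
    obtain ⟨t', ht', hc', hf'⟩ := h (n + i + 2) (by omega)
    by_cases htn' : t' < n
    · rw [extc_paste_left _ _ htn'] at hf'
      exact ⟨t', htn', by omega, hf'⟩
    · rw [extc_paste_eq_false_iff _ _ (by omega) ht'] at hf'
      omega

theorem exists_perOK_paste {ℓ n : ℕ} (hn : ℓ < n) (σ : Config n) (h : PerOK n ℓ σ) :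
    ∃ i ≤ ℓ, PerOK (n + (ℓ + 2)) ℓ (paste ℓ σ i) := by
  rw [perOK_iff_exists_hole hn] at h
  obtain ⟨t₀, ht₀, hc₀, hf₀⟩ := h 0 (by omega)
  have hex : ∃ q, extc σ q = false := ⟨t₀, hf₀⟩
  obtain ⟨q, hq, hmin⟩ : ∃ q, extc σ q = false ∧ ∀ t < q, ¬ extc σ t = false :=
    ⟨Nat.find hex, Nat.find_spec hex, fun t ht => Nat.find_min hex ht⟩
  have hqt : q ≤ t₀ := by
    by_contra hlt
    exact hmin t₀ (by omega) hf₀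
  refine ⟨q, by omega, ?_⟩
  rw [perOK_iff_exists_hole (by omega)]
  intro s hs
  have hqn : q < n := by omega
  have hq' : extc (paste ℓ σ q) q = false := by rwa [extc_paste_left _ _ hqn]
  have h1 : extc (paste ℓ σ q) (n + q) = false :=
    (extc_paste_eq_false_iff _ _ (by omega) (by omega)).mpr (by omega)
  have h2 : extc (paste ℓ σ q) (n + q + 1) = false :=
    (extc_paste_eq_false_iff _ _ (by omega) (by omega)).mpr (by omega)
  by_cases hs1 : s ≤ q
  · exact ⟨q, by omega, by omega, hq'⟩
  by_cases hs2 : n + q + 2 ≤ s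
  · exact ⟨q, by omega, by omega, hq'⟩
  by_cases hs3 : s = n + q + 1
  · exact ⟨n + q + 1, by omega, by omega, h2⟩
  by_cases hs4 : n + q ≤ s + ℓ
  · exact ⟨n + q, by omega, by omega, h1⟩
  obtain ⟨t, ht, hc, hf⟩ := h s (by omega)
  have : ¬ t < q := fun hlt => hmin t hlt hf
  exact ⟨t, by omega, by omega, by rwa [extc_paste_left _ _ ht]⟩

/-- The position of the first empty site after the first `n` ones. -/
def firstHole (n : ℕ) {N : ℕ} (τ : Config N) : ℕ :=
  Nat.find (p := fun k => extc τ (n + k) = false)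
    ⟨N, by simp [extc]⟩

theorem firstHole_spec (n : ℕ) {N : ℕ} (τ : Config N) : extc τ (n + firstHole n τ) = false :=
  Nat.find_spec (p := fun k => extc τ (n + k) = false) _

theorem extc_of_lt_firstHole {n N : ℕ} {τ : Config N} {k : ℕ} (h : k < firstHole n τ) :
    extc τ (n + k) = true := by
  simpa using Nat.find_min (p := fun k => extc τ (n + k) = false) _ h

theorem firstHole_le_of {n N : ℕ} {τ : Config N} {k : ℕ} (h : extc τ (n + k) = false) :
    firstHole n τ ≤ k :=
  Nat.find_min' (p := fun k => extc τ (n + k) = false) _ h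

theorem firstHole_eq_of {n N : ℕ} {τ : Config N} {m : ℕ} (h : extc τ (n + m) = false)
    (h' : ∀ k < m, extc τ (n + k) = true) : firstHole n τ = m := by
  refine le_antisymm (firstHole_le_of h) (not_lt.mp fun hlt => ?_)
  have := h' _ hlt
  rw [firstHole_spec] at this
  exact absurd this (by simp)

theorem firstHole_le {ℓ n : ℕ} (hn : ℓ < n) {τ : Config (n + (ℓ + 2))}
    (h : PerOK (n + (ℓ + 2)) ℓ τ) : firstHole n τ ≤ ℓ := by
  rw [perOK_iff_exists_hole (by omega)] at h
  obtain ⟨t, ht, hc, hf⟩ := h n (by omega)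
  have : firstHole n τ ≤ t - n :=
    firstHole_le_of (by rwa [show n + (t - n) = t by omega])
  omega

theorem firstHole_paste {ℓ n i : ℕ} (hi : i ≤ ℓ) (σ : Config n) :
    firstHole n (paste ℓ σ i) = i := by
  refine firstHole_eq_of ((extc_paste_eq_false_iff _ _ (by omega) (by omega)).mpr (.inl rfl)) ?_
  intro k hk
  have := (extc_paste_eq_false_iff (ℓ := ℓ) σ i (t := n + k) (by omega) (by omega)).not.mpr
    (by omega)
  simpa using this

/-- The site following the first empty site of the pasted part. -/
def pivot (ℓ n : ℕ) (τ : Config (n + (ℓ + 2))) : Fin (n + (ℓ + 2)) :=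
  ⟨min (n + firstHole n τ + 1) (n + ℓ + 1), by omega⟩

theorem pivot_val {ℓ n : ℕ} (hn : ℓ < n) {τ : Config (n + (ℓ + 2))}
    (h : PerOK (n + (ℓ + 2)) ℓ τ) : (pivot ℓ n τ).1 = n + firstHole n τ + 1 := by
  have := firstHole_le hn h
  simp only [pivot]
  omega

theorem eq_paste_of_not_perOK {ℓ n : ℕ} (hn : ℓ < n) {τ : Config (n + (ℓ + 2))}
    (h : PerOK (n + (ℓ + 2)) ℓ τ) (hp : τ (pivot ℓ n τ) = false)
    (h' : ¬ PerOK (n + (ℓ + 2)) ℓ (Function.update τ (pivot ℓ n τ) true)) :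
    τ = paste ℓ (trunc τ) (firstHole n τ) ∧
      ∀ i ≤ ℓ, PerOK (n + (ℓ + 2)) ℓ (paste ℓ (trunc τ) i) → firstHole n τ ≤ i := by
  have hm := firstHole_le hn h
  have hpv := pivot_val hn h
  have hmf := firstHole_spec n τ
  have hlt := fun k => @extc_of_lt_firstHole n _ τ k
  generalize firstHole n τ = m at *
  rw [← extc_val τ, hpv] at hp
  rw [perOK_iff_exists_hole (by omega)] at h h'
  push Not at h'
  obtain ⟨s, hs, h'⟩ := h'
  have h'' : ∀ t < n + (ℓ + 2), (s ≤ t ∧ t ≤ s + ℓ ∨ t + (n + (ℓ + 2)) ≤ s + ℓ) →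
      t ≠ n + m + 1 → extc τ t = true := by
    intro t ht hc hne
    have := h' t ht hc
    rw [extc_update, hpv, if_neg hne] at this
    simpa using this
  obtain ⟨t, ht, hc, hf⟩ := h s hs
  have htm : t = n + m + 1 := by
    by_contra hne
    rw [h'' t ht hc hne] at hf
    exact absurd hf (by simp)
  have hsm : s = n + m + 1 := by
    by_contra hne
    have := h'' (n + m) (by omega) (by omega) (by omega)
    rw [hmf] at this
    exact absurd this (by simp)
  subst hsm
  constructor
  · refine config_ext fun t ht => ?_
    by_cases htn : t < n
    · rw [extc_paste_left _ _ htn, extc_trunc _ htn]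
    · have key := extc_paste_eq_false_iff (trunc τ) m (not_lt.mp htn) ht
      by_cases h1 : t = n + m
      · rw [key.mpr (.inl h1), h1, hmf]
      by_cases h2 : t = n + m + 1
      · rw [key.mpr (.inr h2), h2, hp]
      have h3 : extc (paste ℓ (trunc τ) m) t = true := by
        have := key.not.mpr (by omega)
        simpa using this
      rw [h3]
      by_cases h4 : t < n + m
      · have := hlt (t - n) (by omega)
        rwa [show n + (t - n) = t by omega] at this
      · exact h'' t ht (by omega) h2
  · intro i hi hOK
    by_contra him
    rw [perOK_iff_exists_hole (by omega)] at hOK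
    obtain ⟨u, hu, hcu, hfu⟩ := hOK (n + i + 2) (by omega)
    by_cases hun : u < n
    · rw [extc_paste_left _ _ hun, extc_trunc _ hun, h'' u hu (by omega) (by omega)] at hfu
      exact absurd hfu (by simp)
    · rw [extc_paste_eq_false_iff _ _ (by omega) hu] at hfu
      omega

/-- The last `ℓ + 2` sites are of the form `1ⁱ 00 1^(ℓ-i)`. -/
def IsPaste (ℓ n : ℕ) (τ : Config (n + (ℓ + 2))) : Prop :=
  ∃ i ≤ ℓ, ∀ k < ℓ + 2, extc τ (n + k) = false ↔ k = i ∨ k = i + 1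

theorem isPaste_paste {ℓ n i : ℕ} (hi : i ≤ ℓ) (σ : Config n) : IsPaste ℓ n (paste ℓ σ i) :=
  ⟨i, hi, fun k hk => by
    rw [extc_paste_eq_false_iff _ _ (by omega) (by omega)]; omega⟩

theorem IsPaste.firstHole_le {ℓ n : ℕ} {τ : Config (n + (ℓ + 2))} (h : IsPaste ℓ n τ) :
    firstHole n τ ≤ ℓ := by
  obtain ⟨i, hi, h⟩ := h
  exact (firstHole_le_of ((h i (by omega)).mpr (.inl rfl))).trans hi

theorem IsPaste.eq_paste {ℓ n : ℕ} {τ : Config (n + (ℓ + 2))} (h : IsPaste ℓ n τ) :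
    τ = paste ℓ (trunc τ) (firstHole n τ) := by
  obtain ⟨i, hi, h⟩ := h
  have hfh : firstHole n τ = i := by
    refine firstHole_eq_of ((h i (by omega)).mpr (.inl rfl)) fun k hk => ?_
    have := (h k (by omega)).not.mpr (by omega)
    simpa using this
  rw [hfh]
  refine config_ext fun t ht => ?_
  by_cases htn : t < n
  · rw [extc_paste_left _ _ htn, extc_trunc _ htn]
  · have h1 := h (t - n) (by omega)
    rw [show n + (t - n) = t by omega] at h1
    have h2 := extc_paste_eq_false_iff (trunc τ) i (not_lt.mp htn) ht
    rw [Bool.eq_iff_iff, ← not_iff_not, Bool.not_eq_true, Bool.not_eq_true, h1, h2]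
    omega

theorem isPaste_update_castAdd {ℓ n : ℕ} (τ : Config (n + (ℓ + 2))) (j : Fin n) (b : Bool) :
    IsPaste ℓ n (Function.update τ (Fin.castAdd _ j) b) ↔ IsPaste ℓ n τ := by
  have : ∀ k, extc (Function.update τ (Fin.castAdd _ j) b) (n + k) = extc τ (n + k) := by
    intro k
    rw [extc_update, if_neg]
    have := j.2
    simp only [Fin.val_castAdd]
    omega
  simp only [IsPaste, this]

theorem trunc_update_castAdd {n k : ℕ} (τ : Config (n + k)) (j : Fin n) (b : Bool) :
    trunc (Function.update τ (Fin.castAdd k j) b) = Function.update (trunc τ) j b := by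
  funext i
  by_cases h : i = j
  · subst h; simp [trunc]
  · simp [trunc, h]

theorem trunc_update_of_le {n k : ℕ} (τ : Config (n + k)) {x : Fin (n + k)} (hx : n ≤ x.1)
    (b : Bool) : trunc (Function.update τ x b) = trunc τ := by
  refine config_ext fun t ht => ?_
  rw [extc_trunc _ ht, extc_trunc _ ht, extc_update, if_neg (by omega)]

theorem sgn_castAdd {n k : ℕ} (τ : Config (n + k)) (j : Fin n) :
    sgn τ (Fin.castAdd k j) = sgn (trunc τ) j := by
  have key : ∀ {N : ℕ} (σ : Config N) (i : Fin N),
      sgn σ i = ∏ l, if l < i ∧ σ l = true then (-1 : ℂ) else 1 := by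
    intro N σ i
    simp [sgn, Finset.prod_ite]
  rw [key, key, Fin.prod_univ_add]
  have h2 : ∀ l : Fin k, ¬ (Fin.natAdd n l < Fin.castAdd k j) := by
    intro l
    rw [Fin.lt_def]
    have := j.2
    simp only [Fin.val_natAdd, Fin.val_castAdd]
    omega
  have h3 : ∀ l : Fin n, Fin.castAdd k l < Fin.castAdd k j ↔ l < j := fun l => Iff.rfl
  simp only [h2, h3, false_and, if_false, Finset.prod_const_one, mul_one, trunc]
  congr!

theorem sgn_succ {N : ℕ} (τ : Config N) {x y : Fin N} (hxy : y.1 = x.1 + 1) :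
    sgn τ y = if τ x = true then -sgn τ x else sgn τ x := by
  by_cases h : τ x = true
  · have h1 : Finset.univ.filter (fun k => k < y ∧ τ k = true) =
        insert x (Finset.univ.filter fun k => k < x ∧ τ k = true) := by
      ext k
      by_cases hk : k = x
      · subst hk; simp [h, show k < y from Fin.lt_def.mpr (by omega)]
      · have : k < y ↔ k < x := by
          have := Fin.val_ne_of_ne hk
          rw [Fin.lt_def, Fin.lt_def]; omega
        simp [hk, this]
    rw [if_pos h]
    unfold sgn
    rw [h1, Finset.card_insert_of_notMem (by simp), pow_succ]
    ring
  · rw [if_neg h]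
    unfold sgn
    congr 2
    ext k
    by_cases hk : k = x
    · subst hk; simp [h]
    · have : k < y ↔ k < x := by
        have := Fin.val_ne_of_ne hk
        rw [Fin.lt_def, Fin.lt_def]; omega
      simp [this]

/-- The pasting map on functions on all configurations. -/
def pasteFun (ℓ : ℕ) {n : ℕ} (X : Config n → ℂ) (τ : Config (n + (ℓ + 2))) : ℂ :=
  if IsPaste ℓ n τ then X (trunc τ) else 0

theorem sum_block_eq_zero {ℓ n : ℕ} {τ : Config (n + (ℓ + 2))}
    (h : PerOK (n + (ℓ + 2)) ℓ τ) :
    (∑ k : Fin (ℓ + 2), if τ (Fin.natAdd n k) = true ∧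
      IsPaste ℓ n (Function.update τ (Fin.natAdd n k) false) then
        sgn τ (Fin.natAdd n k) else 0) = 0 := by
  by_cases hex : ∃ k : Fin (ℓ + 2), τ (Fin.natAdd n k) = true ∧
      IsPaste ℓ n (Function.update τ (Fin.natAdd n k) false)
  swap
  · push Not at hex
    exact Finset.sum_eq_zero fun k _ => if_neg fun hk => hex k hk.1 hk.2
  obtain ⟨k₀, hk₀, i, hi, hik⟩ := hex
  simp only [extc_update, Fin.val_natAdd] at hik
  have hk₀' : k₀.1 = i ∨ k₀.1 = i + 1 := (hik k₀.1 k₀.2).mp (by simp)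
  have hk₀2 : extc τ (n + k₀.1) = true := by
    rw [← Fin.val_natAdd n k₀, extc_val, hk₀]
  obtain ⟨c, hc, hcτ⟩ : ∃ c < ℓ + 2, ∀ k < ℓ + 2, extc τ (n + k) = false ↔ k = c := by
    refine ⟨2 * i + 1 - k₀.1, by omega, fun k hk => ?_⟩
    by_cases hkk : k = k₀.1
    · subst hkk
      rw [hk₀2]
      simp only [Bool.true_eq_false, false_iff]
      omega
    · have := hik k hk
      rw [if_neg (by omega)] at this
      rw [this]
      omega
  rw [perOK_iff_exists_hole (by omega)] at h
  have hc1 : c ≤ ℓ := by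
    obtain ⟨t, ht, hct, hft⟩ := h n (by omega)
    rw [show t = n + (t - n) by omega, hcτ _ (by omega)] at hft
    omega
  have hc0 : 1 ≤ c := by
    obtain ⟨t, ht, hct, hft⟩ := h (n + 1) (by omega)
    rw [show t = n + (t - n) by omega, hcτ _ (by omega)] at hft
    omega
  have hocc : ∀ k : Fin (ℓ + 2), τ (Fin.natAdd n k) = true ↔ k.1 ≠ c := by
    intro k
    rw [← extc_val τ, Fin.val_natAdd, ne_eq, ← hcτ _ k.2]
    simp
  have hpaste : ∀ k : Fin (ℓ + 2), k.1 ≠ c →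
      (IsPaste ℓ n (Function.update τ (Fin.natAdd n k) false) ↔ k.1 + 1 = c ∨ k.1 = c + 1) := by
    intro k hk
    have hu : ∀ j < ℓ + 2, extc (Function.update τ (Fin.natAdd n k) false) (n + j) = false ↔
        j = k.1 ∨ j = c := by
      intro j hj
      rw [extc_update, Fin.val_natAdd, ← hcτ j hj]
      by_cases hjk : j = k.1 <;> simp [hjk]
    constructor
    · rintro ⟨i', hi', hx⟩
      have e1 := (hx k.1 k.2).mp ((hu _ k.2).mpr (.inl rfl))
      have e2 := (hx c hc).mp ((hu _ hc).mpr (.inr rfl))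
      omega
    · rintro (hx | hx)
      · exact ⟨k.1, by omega, fun j hj => by rw [hu j hj]; omega⟩
      · exact ⟨c, by omega, fun j hj => by rw [hu j hj]; omega⟩
  let x : Fin (ℓ + 2) := ⟨c - 1, by omega⟩
  let y : Fin (ℓ + 2) := ⟨c, by omega⟩
  let z : Fin (ℓ + 2) := ⟨c + 1, by omega⟩
  have hxz : x ≠ z := by simp [x, z, Fin.ext_iff]
  rw [Finset.sum_eq_add x z hxz]
  · have hx : x.1 ≠ c := by simp only [x]; omega
    have hz : z.1 ≠ c := by simp only [z]; omega
    rw [if_pos ⟨(hocc x).mpr hx, (hpaste x hx).mpr (.inl (by simp only [x]; omega))⟩,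
      if_pos ⟨(hocc z).mpr hz, (hpaste z hz).mpr (.inr rfl)⟩,
      sgn_succ τ (x := Fin.natAdd n y) (y := Fin.natAdd n z) rfl,
      sgn_succ τ (x := Fin.natAdd n x) (y := Fin.natAdd n y)
        (by simp only [Fin.val_natAdd, x, y]; omega),
      if_neg (by rw [hocc]; simp [y]), if_pos ((hocc x).mpr hx), add_neg_cancel]
  · rintro k - ⟨h1, h2⟩
    refine if_neg fun ⟨h3, h4⟩ => ?_
    have hk := (hocc k).mp h3
    rw [hpaste k hk] at h4
    rw [ne_eq, Fin.ext_iff] at h1 h2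
    simp only [x, z] at h1 h2
    omega
  · simp
  · simp

theorem diff_pasteFun {ℓ n : ℕ} (X : Config n → ℂ) {τ : Config (n + (ℓ + 2))}
    (h : PerOK (n + (ℓ + 2)) ℓ τ) : diff (pasteFun ℓ X) τ = pasteFun ℓ (diff X) τ := by
  unfold diff
  rw [Fin.sum_univ_add]
  simp only [pasteFun, isPaste_update_castAdd, trunc_update_castAdd, sgn_castAdd]
  have hblock : ∀ k : Fin (ℓ + 2), trunc (Function.update τ (Fin.natAdd n k) false) = trunc τ :=
    fun k => trunc_update_of_le τ (by simp) _
  simp only [hblock]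
  by_cases hτ : IsPaste ℓ n τ
  · simp only [hτ, if_true]
    rw [add_eq_left.mpr]
    · rfl
    · refine Finset.sum_eq_zero fun k _ => ?_
      by_cases hk : τ (Fin.natAdd n k) = true
      · rw [if_pos hk, if_neg, mul_zero]
        rintro ⟨i', hi', h'⟩
        obtain ⟨i, hi, hτ⟩ := hτ
        have hke : extc τ (n + k.1) = true := by
          rw [← Fin.val_natAdd n k, extc_val, hk]
        have hk' := (hτ k.1 k.2).not.mp (by simp [hke])
        have e1 := (h' k.1 k.2).mp (by simp [extc_update])
        have e2 := (h' i (by omega)).mp (by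
          rw [extc_update]; simp [(hτ i (by omega)).mpr (.inl rfl)])
        have e3 := (h' (i + 1) (by omega)).mp (by
          rw [extc_update]; simp [(hτ (i + 1) (by omega)).mpr (.inr rfl)])
        omega
      · rw [if_neg hk]
  · simp only [hτ, if_false, mul_zero, ite_self, Finset.sum_const_zero, zero_add]
    have := congrArg (· * X (trunc τ)) (sum_block_eq_zero h)
    simp only [Finset.sum_mul, zero_mul] at this
    refine Eq.trans ?_ this
    refine Finset.sum_congr rfl fun k _ => ?_
    by_cases h1 : τ (Fin.natAdd n k) = true <;>
    by_cases h2 : IsPaste ℓ n (Function.update τ (Fin.natAdd n k) false) <;> simp [h1, h2]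

theorem fermions_update_false {N : ℕ} (τ : Config N) {x : Fin N} (h : τ x = true) :
    fermions (Function.update τ x false) + 1 = fermions τ := by
  have : Finset.univ.filter (fun k => τ k = true) =
      insert x (Finset.univ.filter fun k => Function.update τ x false k = true) := by
    ext k
    by_cases hk : k = x
    · subst hk; simp [h]
    · simp [hk]
  rw [fermions, fermions, this, Finset.card_insert_of_notMem (by simp)]

/-- The filtration degree: the lexicographic combination of the fermion number of the first `n`
sites and the position of the first hole after them. -/
def level (ℓ n : ℕ) (τ : Config (n + (ℓ + 2))) : ℕ :=
  fermions (trunc τ) * (ℓ + 3) + firstHole n τ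

theorem firstHole_lt (ℓ n : ℕ) (τ : Config (n + (ℓ + 2))) : firstHole n τ < ℓ + 3 :=
  Nat.lt_succ_of_le (firstHole_le_of (by simp [extc]))

theorem level_lt (ℓ n : ℕ) (τ : Config (n + (ℓ + 2))) :
    level ℓ n τ < n * (ℓ + 3) + (ℓ + 3) := by
  have h1 : fermions (trunc τ) ≤ n := by
    unfold fermions
    exact (Finset.card_filter_le _ _).trans (by simp)
  have := Nat.mul_le_mul_right (ℓ + 3) h1
  have := firstHole_lt ℓ n τ
  unfold level
  omega

theorem level_paste {ℓ n i : ℕ} (hi : i ≤ ℓ) (σ : Config n) :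
    level ℓ n (paste ℓ σ i) = fermions σ * (ℓ + 3) + i := by
  rw [level, trunc_paste, firstHole_paste hi]

theorem level_update_lt {ℓ n : ℕ} {τ : Config (n + (ℓ + 2))} {x : Fin (n + (ℓ + 2))}
    (hx : τ x = true) (hlt : x.1 < n + firstHole n τ) :
    level ℓ n (Function.update τ x false) < level ℓ n τ := by
  unfold level
  by_cases hn : x.1 < n
  · have hx' : x = Fin.castAdd (ℓ + 2) ⟨x.1, hn⟩ := rfl
    have hf := fermions_update_false (trunc τ) (x := ⟨x.1, hn⟩) hx
    rw [← trunc_update_castAdd, ← hx'] at hf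
    rw [← hf, add_mul]
    have := firstHole_lt ℓ n (Function.update τ x false)
    omega
  · rw [trunc_update_of_le τ (not_lt.mp hn)]
    have : firstHole n (Function.update τ x false) ≤ x.1 - n :=
      firstHole_le_of (by rw [extc_update, if_pos (by omega)])
    omega

theorem firstHole_update {ℓ n : ℕ} {τ : Config (n + (ℓ + 2))} {x : Fin (n + (ℓ + 2))}
    (hx : n + firstHole n τ < x.1) (b : Bool) :
    firstHole n (Function.update τ x b) = firstHole n τ := by
  refine firstHole_eq_of ?_ fun k hk => ?_
  · rw [extc_update, if_neg (by omega), firstHole_spec]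
  · rw [extc_update, if_neg (by omega), extc_of_lt_firstHole hk]

theorem level_update {ℓ n : ℕ} {τ : Config (n + (ℓ + 2))} {x : Fin (n + (ℓ + 2))}
    (hx : n + firstHole n τ < x.1) (b : Bool) :
    level ℓ n (Function.update τ x b) = level ℓ n τ := by
  rw [level, level, firstHole_update hx, trunc_update_of_le τ (by omega)]

theorem pivot_update {ℓ n : ℕ} {τ : Config (n + (ℓ + 2))} {x : Fin (n + (ℓ + 2))}
    (hx : n + firstHole n τ < x.1) (b : Bool) :
    pivot ℓ n (Function.update τ x b) = pivot ℓ n τ := by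
  unfold pivot
  simp only [firstHole_update hx]

/-- The contracting homotopy: remove the particle at the pivot. -/
def htpy (ℓ n : ℕ) (Ψ : Config (n + (ℓ + 2)) → ℂ) (τ : Config (n + (ℓ + 2))) : ℂ :=
  if τ (pivot ℓ n τ) = false then
    sgn τ (pivot ℓ n τ) * Ψ (Function.update τ (pivot ℓ n τ) true) else 0

theorem htpy_eq_zero {ℓ n L : ℕ} (hn : ℓ < n) {Ψ : Config (n + (ℓ + 2)) → ℂ}
    (hΨ : ∀ τ, level ℓ n τ < L → Ψ τ = 0) {τ : Config (n + (ℓ + 2))}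
    (h : PerOK (n + (ℓ + 2)) ℓ τ) (hL : level ℓ n τ < L) : htpy ℓ n Ψ τ = 0 := by
  unfold htpy
  split_ifs
  · have hp := pivot_val hn h
    rw [hΨ _ (by rwa [level_update (by omega)]), mul_zero]
  · rfl

theorem level_update_false_le {ℓ n : ℕ} {τ : Config (n + (ℓ + 2))} {x : Fin (n + (ℓ + 2))}
    (hx : τ x = true) : level ℓ n (Function.update τ x false) ≤ level ℓ n τ := by
  rcases lt_trichotomy x.1 (n + firstHole n τ) with h | h | h
  · exact (level_update_lt hx h).le
  · have := firstHole_spec n τ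
    rw [← h, extc_val, hx] at this
    exact absurd this (by simp)
  · rw [level_update h]

theorem diff_htpy_eq_zero {ℓ n L : ℕ} (hn : ℓ < n) {Ψ : Config (n + (ℓ + 2)) → ℂ}
    (hΨ : ∀ τ, level ℓ n τ < L → Ψ τ = 0) {τ : Config (n + (ℓ + 2))}
    (h : PerOK (n + (ℓ + 2)) ℓ τ) (hL : level ℓ n τ < L) : diff (htpy ℓ n Ψ) τ = 0 := by
  refine Finset.sum_eq_zero fun x _ => ?_
  split_ifs with hx
  · rw [htpy_eq_zero hn hΨ (perOK_update τ x h) ((level_update_false_le hx).trans_lt hL), mul_zero]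
  · rfl

theorem diff_htpy {ℓ n L : ℕ} (hn : ℓ < n) {Ψ : Config (n + (ℓ + 2)) → ℂ} {X : Config n → ℂ}
    (hΨ : ∀ τ, level ℓ n τ < L → Ψ τ = 0)
    (hX : ∀ τ, PerOK (n + (ℓ + 2)) ℓ τ → diff Ψ τ = pasteFun ℓ X τ)
    {τ : Config (n + (ℓ + 2))} (h : PerOK (n + (ℓ + 2)) ℓ τ) (hL : level ℓ n τ ≤ L)
    (hτ : PerOK (n + (ℓ + 2)) ℓ (Function.update τ (pivot ℓ n τ) true)) :
    diff (htpy ℓ n Ψ) τ = Ψ τ := by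
  have hpv := pivot_val hn h
  have hm := firstHole_le hn h
  have hpu : ∀ x : Fin (n + (ℓ + 2)), n + firstHole n τ < x.1 →
      pivot ℓ n (Function.update τ x false) = pivot ℓ n τ := fun x hx => pivot_update hx _
  have hlow : ∀ x, τ x = true → x.1 < n + firstHole n τ →
      htpy ℓ n Ψ (Function.update τ x false) = 0 := fun x hx hlt =>
    htpy_eq_zero hn hΨ (perOK_update τ x h) ((level_update_lt hx hlt).trans_le hL)
  have hhigh : ∀ x, τ x = true → ¬ x.1 < n + firstHole n τ → x ≠ pivot ℓ n τ →
      pivot ℓ n τ < x := by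
    intro x hx hlt hxp
    have h1 : x.1 ≠ n + firstHole n τ := by
      intro h1
      have := firstHole_spec n τ
      rw [← h1, extc_val, hx] at this
      exact absurd this (by simp)
    rw [ne_eq, Fin.ext_iff] at hxp
    rw [Fin.lt_def]
    omega
  have hlt' : ∀ {x}, pivot ℓ n τ ≤ x → n + firstHole n τ < x.1 := by
    intro x hx
    rw [Fin.le_def] at hx
    omega
  generalize pivot ℓ n τ = p at hτ hpv hpu hhigh hlt'
  by_cases hpτ : τ p = true
  · unfold diff
    rw [Finset.sum_eq_single p]
    · rw [if_pos hpτ, htpy, hpu p (hlt' le_rfl), if_pos (by simp), sgn_update_of_le _ le_rfl,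
        Function.update_idem, ← mul_assoc, sgn_mul_self, one_mul, ← hpτ, Function.update_eq_self]
    · intro x _ hxp
      split_ifs with hx
      · by_cases hlt : x.1 < n + firstHole n τ
        · rw [hlow x hx hlt, mul_zero]
        · have hpx := hhigh x hx hlt hxp
          rw [htpy, hpu x (hlt' hpx.le), if_neg, mul_zero]
          rw [Function.update_of_ne hpx.ne, hpτ]
          simp
      · rfl
    · simp
  · rw [Bool.not_eq_true] at hpτ
    set τ' := Function.update τ p true with hτ'
    have hlt := hlt' (le_refl p)
    have hcoc : diff Ψ τ' = 0 := by
      rw [hX τ' hτ, pasteFun, if_neg]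
      intro hpaste
      have hfl := hpaste.firstHole_le
      have hfh : firstHole n τ' = firstHole n τ := firstHole_update hlt _
      have h2 := congrArg (fun σ => extc σ p.1) hpaste.eq_paste
      simp only [hfh] at h2
      rw [(extc_paste_eq_false_iff _ _ (by omega) p.2).mpr (by omega), extc_val] at h2
      simp [hτ'] at h2
    have hterm : ∀ x, x ≠ p →
        (if τ x = true then sgn τ x * htpy ℓ n Ψ (Function.update τ x false) else 0) =
        -sgn τ p * (if τ' x = true then sgn τ' x * Ψ (Function.update τ' x false) else 0) := by
      intro x hxp
      have hxx : τ' x = τ x := Function.update_of_ne hxp _ _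
      rw [hxx]
      by_cases hx : τ x = true
      swap
      · rw [if_neg hx, if_neg hx, mul_zero]
      rw [if_pos hx, if_pos hx]
      by_cases hlt1 : x.1 < n + firstHole n τ
      · have hfh : firstHole n τ' = firstHole n τ := firstHole_update hlt _
        have hlev : level ℓ n τ' = level ℓ n τ := level_update hlt _
        have h3 := level_update_lt (hxx.trans hx) (by omega : x.1 < n + firstHole n τ')
        rw [hlow x hx hlt1, hΨ _ (by omega)]
        ring
      · have hpx := hhigh x hx hlt1 hxp
        rw [htpy, hpu x (hlt' hpx.le), if_pos (by rw [Function.update_of_ne hpx.ne, hpτ]),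
          sgn_update_of_le _ hpx.le, hτ', sgn_update_true_of_lt _ hpx hpτ,
          Function.update_comm hpx.ne]
        ring
    have hsplit := Finset.add_sum_erase Finset.univ
      (fun x => if τ' x = true then sgn τ' x * Ψ (Function.update τ' x false) else 0)
      (Finset.mem_univ p)
    have hsum : diff (htpy ℓ n Ψ) τ = ∑ x ∈ Finset.univ.erase p,
        (if τ x = true then sgn τ x * htpy ℓ n Ψ (Function.update τ x false) else 0) := by
      rw [Finset.sum_erase _ (by simp [hpτ])]
      rfl
    rw [hsum, Finset.sum_congr rfl fun x hx => hterm x (Finset.ne_of_mem_erase hx),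
      ← Finset.mul_sum]
    have hpp : (if τ' p = true then sgn τ' p * Ψ (Function.update τ' p false) else 0) =
        sgn τ p * Ψ τ := by
      rw [if_pos (by simp [hτ']), hτ', Function.update_idem, sgn_update_of_le _ le_rfl, ← hpτ,
        Function.update_eq_self]
    have hz : sgn τ p * Ψ τ + ∑ x ∈ Finset.univ.erase p,
        (if τ' x = true then sgn τ' x * Ψ (Function.update τ' x false) else 0) = 0 := by
      rw [← hpp]
      exact hsplit.trans hcoc
    rw [eq_neg_of_add_eq_zero_right hz]
    have := sgn_mul_self τ p
    linear_combination Ψ τ * this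

/-- The pasting map from the chain of `n` sites to the chain of `n + (ℓ + 2)` sites. -/
def pasteMap (ℓ n : ℕ) :
    AState n (PerOK n ℓ) →ₗ[ℂ] AState (n + (ℓ + 2)) (PerOK (n + (ℓ + 2)) ℓ) where
  toFun χ τ := pasteFun ℓ (ext0 χ) τ.1
  map_add' χ χ' := by
    funext τ
    simp only [pasteFun, ext0, Pi.add_apply]
    split_ifs <;> simp
  map_smul' c χ := by
    funext τ
    simp only [pasteFun, ext0, Pi.smul_apply, RingHom.id_apply]
    split_ifs <;> simp

theorem pasteMap_apply {ℓ n : ℕ} (χ : AState n (PerOK n ℓ))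
    (τ : {τ // PerOK (n + (ℓ + 2)) ℓ τ}) : pasteMap ℓ n χ τ = pasteFun ℓ (ext0 χ) τ.1 := rfl

theorem Qop_perOK_apply {N ℓ : ℕ} (ψ : AState N (PerOK N ℓ)) (τ : {τ // PerOK N ℓ τ}) :
    Qop N (PerOK N ℓ) (fun _ => True) ψ τ = diff (ext0 ψ) τ.1 :=
  Qop_apply perOK_update _ _ (ext0_val ψ) τ

theorem IsPaste.perOK_trunc {ℓ n : ℕ} (hn : ℓ < n) {τ : Config (n + (ℓ + 2))}
    (hτ : IsPaste ℓ n τ) (h : PerOK (n + (ℓ + 2)) ℓ τ) : PerOK n ℓ (trunc τ) := by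
  rw [hτ.eq_paste] at h
  exact perOK_of_paste hn hτ.firstHole_le _ h

theorem Qop_pasteMap {ℓ n : ℕ} (hn : ℓ < n) (χ : AState n (PerOK n ℓ)) :
    Qop _ (PerOK (n + (ℓ + 2)) ℓ) (fun _ => True) (pasteMap ℓ n χ) =
      pasteMap ℓ n (Qop _ (PerOK n ℓ) (fun _ => True) χ) := by
  funext τ
  rw [Qop_apply perOK_update (pasteMap ℓ n χ) (pasteFun ℓ (ext0 χ)) (fun σ => rfl), diff_pasteFun _ τ.2,
    pasteMap_apply, pasteFun, pasteFun]
  split_ifs with h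
  · have := ext0_val (Qop _ (PerOK n ℓ) (fun _ => True) χ) ⟨_, h.perOK_trunc hn τ.2⟩
    rw [this, Qop_perOK_apply]
  · rfl

theorem pasteMap_injective {ℓ n : ℕ} (hn : ℓ < n) : Function.Injective (pasteMap ℓ n) := by
  intro χ χ' h
  funext σ
  obtain ⟨i, hi, hOK⟩ := exists_perOK_paste hn σ.1 σ.2
  have := congrFun h ⟨_, hOK⟩
  rwa [pasteMap_apply, pasteMap_apply, pasteFun, pasteFun, if_pos (isPaste_paste hi _),
    if_pos (isPaste_paste hi _), trunc_paste, ext0_val, ext0_val] at this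

/-- A state whose coboundary lies in the range of the pasting map, and which vanishes below
filtration degree `L`, vanishes up to filtration degree `L` modulo coboundaries and pasted
states. -/
theorem exists_vanishing_succ {ℓ n L : ℕ} (hn : ℓ < n)
    {ψ : AState (n + (ℓ + 2)) (PerOK (n + (ℓ + 2)) ℓ)} {χ : AState n (PerOK n ℓ)}
    (hψ : ∀ τ, level ℓ n τ.1 < L → ψ τ = 0)
    (hχ : Qop _ (PerOK (n + (ℓ + 2)) ℓ) (fun _ => True) ψ = pasteMap ℓ n χ) :
    ∃ η ξ, ∀ τ, level ℓ n τ.1 < L + 1 →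
      (ψ - Qop _ (PerOK (n + (ℓ + 2)) ℓ) (fun _ => True) η - pasteMap ℓ n ξ) τ = 0 := by
  have hΨ : ∀ τ, level ℓ n τ < L → ext0 ψ τ = 0 := by
    intro τ hτ
    unfold ext0
    split_ifs with h
    · exact hψ _ hτ
    · rfl
  have hX : ∀ τ, PerOK (n + (ℓ + 2)) ℓ τ → diff (ext0 ψ) τ = pasteFun ℓ (ext0 χ) τ := by
    intro τ h
    rw [← pasteMap_apply χ ⟨τ, h⟩, ← hχ, Qop_perOK_apply]
  let η : AState (n + (ℓ + 2)) (PerOK (n + (ℓ + 2)) ℓ) := fun τ => htpy ℓ n (ext0 ψ) τ.1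
  set u := ψ - Qop _ (PerOK (n + (ℓ + 2)) ℓ) (fun _ => True) η with hu
  have huτ : ∀ τ, u τ = ext0 ψ τ.1 - diff (htpy ℓ n (ext0 ψ)) τ.1 := by
    intro τ
    rw [hu, Pi.sub_apply, Qop_apply perOK_update η (htpy ℓ n (ext0 ψ)) (fun _ => rfl), ext0_val]
  have hu_low : ∀ τ, level ℓ n τ.1 < L → u τ = 0 := by
    intro τ hτ
    rw [huτ, hΨ _ hτ, diff_htpy_eq_zero hn hΨ τ.2 hτ, sub_zero]
  have hu_reg : ∀ τ : {τ // PerOK (n + (ℓ + 2)) ℓ τ}, level ℓ n τ.1 ≤ L →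
      PerOK (n + (ℓ + 2)) ℓ (Function.update τ.1 (pivot ℓ n τ.1) true) → u τ = 0 := by
    intro τ hτ h
    rw [huτ, diff_htpy hn hΨ hX τ.2 hτ h, sub_self]
  have hcrit : ∀ τ : {τ // PerOK (n + (ℓ + 2)) ℓ τ},
      ¬ PerOK (n + (ℓ + 2)) ℓ (Function.update τ.1 (pivot ℓ n τ.1) true) →
      τ.1 = paste ℓ (trunc τ.1) (firstHole n τ.1) ∧
      ∀ i ≤ ℓ, PerOK (n + (ℓ + 2)) ℓ (paste ℓ (trunc τ.1) i) → firstHole n τ.1 ≤ i := by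
    intro τ h
    refine eq_paste_of_not_perOK hn τ.2 ?_ h
    by_contra hp
    rw [Bool.not_eq_false] at hp
    rw [← hp, Function.update_eq_self] at h
    exact h τ.2
  let S : Config n → Set ℕ := fun σ => {i | i ≤ ℓ ∧ PerOK (n + (ℓ + 2)) ℓ (paste ℓ σ i)}
  refine ⟨η, fun σ => ext0 u (paste ℓ σ.1 (sInf (S σ.1))), fun τ hτ => ?_⟩
  have hm := firstHole_le hn τ.2
  rw [← hu, Pi.sub_apply, pasteMap_apply, pasteFun]
  split_ifs with hpaste
  · have heq := hpaste.eq_paste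
    rw [ext0, dif_pos (hpaste.perOK_trunc hn τ.2)]
    dsimp only
    have hmem : firstHole n τ.1 ∈ S (trunc τ.1) := ⟨hm, by rw [← heq]; exact τ.2⟩
    have hinf : sInf (S (trunc τ.1)) ∈ S (trunc τ.1) := Nat.sInf_mem ⟨_, hmem⟩
    have hle : sInf (S (trunc τ.1)) ≤ firstHole n τ.1 := Nat.sInf_le hmem
    generalize sInf (S (trunc τ.1)) = j at *
    rcases hle.eq_or_lt with hj | hj
    · rw [hj, ← heq, ext0_val, sub_self]
    · have hlev := level_paste hinf.1 (trunc τ.1)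
      have hτl : level ℓ n τ.1 = fermions (trunc τ.1) * (ℓ + 3) + firstHole n τ.1 := rfl
      have h1 : ext0 u (paste ℓ (trunc τ.1) j) = 0 := by
        have := ext0_val u ⟨_, hinf.2⟩
        rw [this]
        exact hu_low _ (by dsimp only; omega)
      rw [h1, sub_zero]
      by_contra hne
      have h2 := (hcrit τ fun h => hne (hu_reg τ (by omega) h)).2 j hinf.1 hinf.2
      omega
  · rw [sub_zero]
    refine hu_reg τ (by omega) ?_
    by_contra h
    apply hpaste
    rw [(hcrit τ h).1]
    exact isPaste_paste hm _

/-- The cokernel of the pasting map is acyclic. -/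
theorem exists_eq_Qop_add_pasteMap {ℓ n : ℕ} (hn : ℓ < n)
    {ψ : AState (n + (ℓ + 2)) (PerOK (n + (ℓ + 2)) ℓ)} {χ : AState n (PerOK n ℓ)}
    (hχ : Qop _ (PerOK (n + (ℓ + 2)) ℓ) (fun _ => True) ψ = pasteMap ℓ n χ) :
    ∃ η ξ, ψ = Qop _ (PerOK (n + (ℓ + 2)) ℓ) (fun _ => True) η + pasteMap ℓ n ξ := by
  have key : ∀ L, ∃ η ξ, ∀ τ, level ℓ n τ.1 < L →
      (ψ - Qop _ (PerOK (n + (ℓ + 2)) ℓ) (fun _ => True) η - pasteMap ℓ n ξ) τ = 0 := by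
    intro L
    induction L with
    | zero => exact ⟨0, 0, fun τ h => absurd h (Nat.not_lt_zero _)⟩
    | succ L ih =>
      obtain ⟨η, ξ, h⟩ := ih
      obtain ⟨η', ξ', h'⟩ := exists_vanishing_succ hn
        (χ := χ - Qop _ (PerOK n ℓ) (fun _ => True) ξ) h (by
          rw [map_sub, map_sub, map_sub, Qop_Qop perOK_update, Qop_pasteMap hn, hχ, sub_zero])
      refine ⟨η + η', ξ + ξ', fun τ hτ => ?_⟩
      rw [← h' τ hτ, map_add, map_add]
      refine congrFun ?_ τ
      abel
  obtain ⟨η, ξ, h⟩ := key (n * (ℓ + 3) + (ℓ + 3))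
  refine ⟨η, ξ, ?_⟩
  rw [← sub_eq_zero, ← sub_sub]
  funext τ
  exact h τ (level_lt ℓ n τ.1)

/-- The projection onto the states of fermion number `f`. -/
def gradeProj {N : ℕ} {OK : Config N → Prop} (f : ℕ) (ψ : AState N OK) : AState N OK :=
  fun σ => if fermions σ.1 = f then ψ σ else 0

theorem gradeProj_mem {N : ℕ} {OK : Config N → Prop} (f : ℕ) (ψ : AState N OK) :
    gradeProj f ψ ∈ gradeV N OK f := fun _ h => if_neg h

theorem gradeProj_eq_self {N : ℕ} {OK : Config N → Prop} {f : ℕ} {ψ : AState N OK}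
    (h : ψ ∈ gradeV N OK f) : gradeProj f ψ = ψ := by
  funext σ
  unfold gradeProj
  split_ifs with hσ
  · rfl
  · exact (h σ hσ).symm

theorem gradeProj_add {N : ℕ} {OK : Config N → Prop} (f : ℕ) (ψ φ : AState N OK) :
    gradeProj f (ψ + φ) = gradeProj f ψ + gradeProj f φ := by
  funext σ
  simp only [gradeProj, Pi.add_apply]
  split_ifs <;> simp

theorem gradeProj_succ_Qop {N : ℕ} {OK : Config N → Prop}
    (hOK : ∀ τ x, OK τ → OK (Function.update τ x false)) (f : ℕ) (ψ : AState N OK) :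
    gradeProj (f + 1) (Qop N OK (fun _ => True) ψ) =
      Qop N OK (fun _ => True) (gradeProj f ψ) := by
  funext τ
  rw [Qop_apply hOK (gradeProj f ψ) _ (ext0_val _), gradeProj, Qop_apply hOK _ _ (ext0_val _),
    diff, diff]
  have hterm : ∀ x, τ.1 x = true → ext0 (gradeProj f ψ) (Function.update τ.1 x false) =
      if fermions τ.1 = f + 1 then ext0 ψ (Function.update τ.1 x false) else 0 := by
    intro x hx
    rw [ext0, ext0, dif_pos (hOK _ _ τ.2), dif_pos (hOK _ _ τ.2), gradeProj,
      ← fermions_update_false τ.1 hx]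
    simp only [add_left_inj]
  split_ifs with h
  · refine Finset.sum_congr rfl fun x _ => ?_
    split_ifs with hx
    · rw [hterm x hx, if_pos h]
    · rfl
  · refine (Finset.sum_eq_zero fun x _ => ?_).symm
    split_ifs with hx
    · rw [hterm x hx, if_neg h, mul_zero]
    · rfl

theorem gradeProj_zero_Qop {N : ℕ} {OK : Config N → Prop}
    (hOK : ∀ τ x, OK τ → OK (Function.update τ x false)) (ψ : AState N OK) :
    gradeProj 0 (Qop N OK (fun _ => True) ψ) = 0 := by
  funext τ
  unfold gradeProj
  split_ifs with h
  · rw [Qop_apply hOK _ _ (ext0_val _)]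
    refine Finset.sum_eq_zero fun x _ => if_neg fun hx => ?_
    have := fermions_update_false τ.1 hx
    omega
  · rfl

theorem fermions_paste {ℓ n i : ℕ} (hi : i ≤ ℓ) (σ : Config n) :
    fermions (paste ℓ σ i) = fermions σ + ℓ := by
  have key : ∀ {N : ℕ} (σ : Config N), fermions σ = ∑ k, if σ k = true then 1 else 0 := by
    intro N σ
    rw [fermions, Finset.card_filter]
  rw [key, key, Fin.sum_univ_add]
  congr 1
  · refine Finset.sum_congr rfl fun k _ => ?_
    simp [paste]
  · let x : Fin (ℓ + 2) := ⟨i, by omega⟩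
    let y : Fin (ℓ + 2) := ⟨i + 1, by omega⟩
    have hxy : y ≠ x := by simp [x, y]
    have hset : Finset.univ.filter (fun k => paste ℓ σ i (Fin.natAdd n k) = true) =
        (Finset.univ.erase x).erase y := by
      ext k
      simp [paste, x, y, Fin.ext_iff]
      omega
    rw [← Finset.card_filter, hset, Finset.card_erase_of_mem (by simp [hxy]),
      Finset.card_erase_of_mem (by simp)]
    simp

theorem gradeProj_pasteMap {ℓ n : ℕ} (f : ℕ) (χ : AState n (PerOK n ℓ)) :
    gradeProj (f + ℓ) (pasteMap ℓ n χ) = pasteMap ℓ n (gradeProj f χ) := by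
  funext τ
  rw [gradeProj, pasteMap_apply, pasteMap_apply, pasteFun, pasteFun]
  by_cases h : IsPaste ℓ n τ.1
  · have hf : fermions τ.1 = fermions (trunc τ.1) + ℓ := by
      conv_lhs => rw [h.eq_paste]
      exact fermions_paste h.firstHole_le _
    rw [if_pos h, if_pos h, hf, ext0, ext0]
    simp only [add_left_inj, gradeProj]
    split_ifs <;> rfl
  · simp [h]

theorem pasteMap_mem_gradeV {ℓ n f : ℕ} {χ : AState n (PerOK n ℓ)}
    (h : χ ∈ gradeV n (PerOK n ℓ) f) : pasteMap ℓ n χ ∈ gradeV _ _ (f + ℓ) := by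
  rw [← gradeProj_eq_self h, ← gradeProj_pasteMap]
  exact gradeProj_mem _ _

theorem pasteMap_mem_cocycles {ℓ n f : ℕ} (hn : ℓ < n) {χ : AState n (PerOK n ℓ)}
    (h : χ ∈ cocycles n (PerOK n ℓ) (fun _ => True) f) :
    pasteMap ℓ n χ ∈ cocycles _ (PerOK (n + (ℓ + 2)) ℓ) (fun _ => True) (f + ℓ) := by
  refine ⟨?_, pasteMap_mem_gradeV h.2⟩
  refine LinearMap.mem_ker.mpr ?_
  rw [Qop_pasteMap hn, LinearMap.mem_ker.mp h.1, map_zero]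

theorem pasteMap_mem_cobounds_iff {ℓ n f : ℕ} (hn : ℓ < n)
    {χ : AState n (PerOK n ℓ)} (h : χ ∈ gradeV n (PerOK n ℓ) f) :
    pasteMap ℓ n χ ∈ cobounds _ (PerOK (n + (ℓ + 2)) ℓ) (fun _ => True) (f + ℓ) ↔
      χ ∈ cobounds n (PerOK n ℓ) (fun _ => True) f := by
  constructor
  · rintro ⟨η, -, hη⟩
    obtain ⟨η', ξ, rfl⟩ := exists_eq_Qop_add_pasteMap hn hη
    rw [map_add, Qop_Qop perOK_update, zero_add, Qop_pasteMap hn] at hη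
    have hχ := pasteMap_injective hn hη
    cases f with
    | zero =>
      rw [← gradeProj_eq_self h, ← hχ, gradeProj_zero_Qop perOK_update]
      exact zero_mem _
    | succ f =>
      refine ⟨gradeProj f ξ, gradeProj_mem _ _, ?_⟩
      rw [← gradeProj_succ_Qop perOK_update, hχ, gradeProj_eq_self h]
  · rintro ⟨ξ, hξ, rfl⟩
    rw [← Qop_pasteMap hn]
    cases f with
    | zero =>
      have : Qop n (PerOK n ℓ) (fun _ => True) ξ = 0 := by
        rw [← gradeProj_eq_self h, gradeProj_zero_Qop perOK_update]
      rw [Qop_pasteMap hn, this, map_zero]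
      exact zero_mem _
    | succ f =>
      have hg := pasteMap_mem_gradeV hξ
      exact ⟨_, by rwa [show f + 1 + ℓ - 1 = f + 1 - 1 + ℓ by omega], rfl⟩

theorem exists_cocycle_sub_mem_cobounds {ℓ n f : ℕ} (hℓ : 1 ≤ ℓ) (hn : ℓ < n)
    {ψ : AState (n + (ℓ + 2)) (PerOK (n + (ℓ + 2)) ℓ)}
    (h : ψ ∈ cocycles _ (PerOK (n + (ℓ + 2)) ℓ) (fun _ => True) (f + ℓ)) :
    ∃ χ ∈ cocycles n (PerOK n ℓ) (fun _ => True) f,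
      pasteMap ℓ n χ - ψ ∈ cobounds _ (PerOK (n + (ℓ + 2)) ℓ) (fun _ => True) (f + ℓ) := by
  have hQ := LinearMap.mem_ker.mp h.1
  obtain ⟨η, ξ, hψ⟩ := exists_eq_Qop_add_pasteMap hn (χ := 0) (hQ.trans (map_zero _).symm)
  obtain ⟨g, hg⟩ : ∃ g, f + ℓ = g + 1 := ⟨f + ℓ - 1, by omega⟩
  have hψ' : ψ = Qop _ (PerOK (n + (ℓ + 2)) ℓ) (fun _ => True) (gradeProj g η) +
      pasteMap ℓ n (gradeProj f ξ) := by
    rw [← gradeProj_succ_Qop perOK_update, ← gradeProj_pasteMap, ← hg, ← gradeProj_add, ← hψ,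
      gradeProj_eq_self h.2]
  refine ⟨gradeProj f ξ, ⟨?_, gradeProj_mem _ _⟩, ?_⟩
  · refine LinearMap.mem_ker.mpr ?_
    apply pasteMap_injective hn
    rw [← Qop_pasteMap hn, map_zero]
    rw [hψ', map_add, Qop_Qop perOK_update, zero_add] at hQ
    exact hQ
  · rw [hψ', sub_add_cancel_right]
    refine neg_mem ⟨_, ?_, rfl⟩
    rw [hg, Nat.add_sub_cancel]
    exact gradeProj_mem _ _

/-- The pasting map induces an isomorphism in cohomology. -/
theorem nonempty_cohSpace_equiv {ℓ n : ℕ} (hℓ : 1 ≤ ℓ) (hn : ℓ < n) (f : ℕ) :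
    Nonempty (CohSpace n (PerOK n ℓ) (fun _ => True) f ≃ₗ[ℂ]
      CohSpace (n + (ℓ + 2)) (PerOK (n + (ℓ + 2)) ℓ) (fun _ => True) (f + ℓ)) := by
  let g : cocycles n (PerOK n ℓ) (fun _ => True) f →ₗ[ℂ]
      cocycles _ (PerOK (n + (ℓ + 2)) ℓ) (fun _ => True) (f + ℓ) :=
    (pasteMap ℓ n).restrict fun _ h => pasteMap_mem_cocycles hn h
  let F := Submodule.mapQ
    ((cobounds n (PerOK n ℓ) (fun _ => True) f).comap (cocycles _ _ _ _).subtype)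
    ((cobounds _ (PerOK (n + (ℓ + 2)) ℓ) (fun _ => True) (f + ℓ)).comap (cocycles _ _ _ _).subtype) g
    fun χ hχ => (pasteMap_mem_cobounds_iff hn χ.2.2).mpr hχ
  have hF : ∀ χ, F (Submodule.Quotient.mk χ) = Submodule.Quotient.mk (g χ) := fun _ => rfl
  refine ⟨LinearEquiv.ofBijective F ⟨?_, ?_⟩⟩
  · rw [← LinearMap.ker_eq_bot, LinearMap.ker_eq_bot']
    intro x hx
    obtain ⟨χ, rfl⟩ := Submodule.Quotient.mk_surjective _ x
    rw [hF, Submodule.Quotient.mk_eq_zero] at hx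
    rw [Submodule.Quotient.mk_eq_zero]
    exact (pasteMap_mem_cobounds_iff hn χ.2.2).mp hx
  · intro y
    obtain ⟨ψ, rfl⟩ := Submodule.Quotient.mk_surjective _ y
    obtain ⟨χ, hχ, hsub⟩ := exists_cocycle_sub_mem_cobounds hℓ hn ψ.2
    refine ⟨Submodule.Quotient.mk ⟨χ, hχ⟩, ?_⟩
    rw [hF, Submodule.Quotient.eq]
    exact hsub

/-- Cut (and paste), periodic case: for the `M_ℓ` model on the closed chain of
`N = Ñ + (ℓ+2) > 2ℓ+2` sites with periodic boundary conditions, the cohomology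
`H_Q^f` at any grade `f ≥ ℓ` is isomorphic to the cohomology `H_Q^{f-ℓ}` of the
closed chain of `Ñ` sites with periodic boundary conditions; in particular their
dimensions are equal. -/
theorem cut_and_paste_periodic (ℓ Nt : ℕ) (hℓ : 1 ≤ ℓ) (hNt : ℓ < Nt)
    (f : ℕ) (hf : ℓ ≤ f) :
    Nonempty (CohSpace (Nt + (ℓ + 2)) (PerOK (Nt + (ℓ + 2)) ℓ) (fun _ => True) f ≃ₗ[ℂ]
        CohSpace Nt (PerOK Nt ℓ) (fun _ => True) (f - ℓ)) ∧
    cohDim (Nt + (ℓ + 2)) (PerOK (Nt + (ℓ + 2)) ℓ) (fun _ => True) f =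
      cohDim Nt (PerOK Nt ℓ) (fun _ => True) (f - ℓ) := by
  obtain ⟨g, rfl⟩ := Nat.exists_eq_add_of_le' hf
  rw [Nat.add_sub_cancel]
  obtain ⟨e⟩ := nonempty_cohSpace_equiv hℓ hNt g
  exact ⟨⟨e.symm⟩, e.symm.finrank_eq⟩

end
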